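/- arXiv:math/0010008 — 4 statements merged into one kernel-verified Lean document; each statement's English description precedes it below -/
import Mathlib

section
/- Let ε : [0,∞) → [0,∞) be continuous with ∫₀^∞ ε(t) dt < ∞, and let c : [0,∞) → ℝ be differentiable with c'(t) = c(t) − ε(t) for all t ≥ 0 and initial value c(0) = ∫₀^∞ ε(τ) e^{−τ} dτ. Then for every t ≥ 0 one has c(t) = ∫_t^∞ ε(τ) e^{−(τ−t)} dτ; in particular 0 ≤ c(t) ≤ ∫_t^∞ ε(τ) dτ for all t ≥ 0, and c(t) → 0 as t → ∞. -/
open MeasureTheory Filter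

/-- A function that is integrable on `[0,∞)` stays integrable there when multiplied by `e^{-τ}`. -/
lemma MeasureTheory.IntegrableOn.mul_exp_neg_Ici {ε : ℝ → ℝ} (hε : IntegrableOn ε (Set.Ici 0)) :
    IntegrableOn (fun τ => ε τ * Real.exp (-τ)) (Set.Ici 0) := by
  refine Integrable.mul_bdd (c := 1) hε
    (Real.continuous_exp.comp continuous_neg).aestronglyMeasurable ?_
  filter_upwards [ae_restrict_mem measurableSet_Ici] with τ hτ
  rw [Real.norm_eq_abs, Real.abs_exp, Real.exp_le_one_iff]
  exact neg_nonpos.mpr hτ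

/-- Variation of constants for `c' = c - ε`. -/
lemma integral_mul_exp_neg_of_hasDerivAt {ε c : ℝ → ℝ} (hε : IntegrableOn ε (Set.Ici 0))
    (hc : ∀ t, 0 ≤ t → HasDerivAt c (c t - ε t) t) {t : ℝ} (ht : 0 ≤ t) :
    ∫ τ in (0 : ℝ)..t, ε τ * Real.exp (-τ) = c 0 - c t * Real.exp (-t) := by
  have hd : ∀ τ ∈ Set.uIcc 0 t,
      HasDerivAt (fun s => -(c s * Real.exp (-s))) (ε τ * Real.exp (-τ)) τ := by
    intro τ hτ
    rw [Set.uIcc_of_le ht] at hτ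
    exact ((hc τ hτ.1).mul (hasDerivAt_neg τ).exp).neg.congr_deriv (by ring)
  have hi : IntervalIntegrable (fun τ => ε τ * Real.exp (-τ)) volume 0 t := by
    rw [intervalIntegrable_iff_integrableOn_Icc_of_le ht]
    exact hε.mul_exp_neg_Ici.mono_set Set.Icc_subset_Ici_self
  rw [intervalIntegral.integral_eq_sub_of_hasDerivAt hd hi]
  simp
  ring

/-- Normalization lemma: if `c' = c - ε` with `ε ≥ 0` continuous and integrable on `[0,∞)`,
and `c 0 = ∫₀^∞ ε(τ) e^{-τ} dτ`, then `c t = ∫_t^∞ ε(τ) e^{-(τ-t)} dτ`, in particular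
`0 ≤ c t ≤ ∫_t^∞ ε(τ) dτ` and `c t → 0` as `t → ∞`. -/
theorem normalization_lemma (ε c : ℝ → ℝ)
    (hε_cont : ContinuousOn ε (Set.Ici 0))
    (hε_nonneg : ∀ t, 0 ≤ t → 0 ≤ ε t)
    (hε_int : IntegrableOn ε (Set.Ici 0))
    (hc_deriv : ∀ t, 0 ≤ t → HasDerivAt c (c t - ε t) t)
    (hc0 : c 0 = ∫ τ in Set.Ici (0 : ℝ), ε τ * Real.exp (-τ)) :
    (∀ t, 0 ≤ t → c t = ∫ τ in Set.Ici t, ε τ * Real.exp (-(τ - t))) ∧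
    (∀ t, 0 ≤ t → 0 ≤ c t ∧ c t ≤ ∫ τ in Set.Ici t, ε τ) ∧
    Tendsto c atTop (nhds 0) := by
  have hI := hε_int.mul_exp_neg_Ici
  have hexp : ∀ t τ, ε τ * Real.exp (-(τ - t)) = Real.exp t * (ε τ * Real.exp (-τ)) := by
    intro t τ
    rw [show -(τ - t) = t + -τ by ring, Real.exp_add]
    ring
  have hc : ∀ t, 0 ≤ t → c t = ∫ τ in Set.Ici t, ε τ * Real.exp (-(τ - t)) := by
    intro t ht
    have h := intervalIntegral.integral_Ioi_sub_Ioi (hI.mono_set Set.Ioi_subset_Ici_self) ht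
    rw [integral_mul_exp_neg_of_hasDerivAt hε_int hc_deriv ht, hc0, integral_Ici_eq_integral_Ioi,
      sub_right_inj] at h
    simp_rw [hexp, integral_const_mul, integral_Ici_eq_integral_Ioi, h]
    rw [mul_left_comm, ← Real.exp_add]
    simp
  have hbound : ∀ t, 0 ≤ t → 0 ≤ c t ∧ c t ≤ ∫ τ in Set.Ici t, ε τ := by
    intro t ht
    have hsub : Set.Ici t ⊆ Set.Ici 0 := Set.Ici_subset_Ici.mpr ht
    rw [hc t ht]
    refine ⟨setIntegral_nonneg measurableSet_Ici fun τ hτ =>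
      mul_nonneg (hε_nonneg τ (hsub hτ)) (Real.exp_pos _).le, ?_⟩
    refine setIntegral_mono_on ?_ (hε_int.mono_set hsub) measurableSet_Ici fun τ hτ => ?_
    · simp_rw [hexp]
      exact (hI.mono_set hsub).const_mul _
    · exact mul_le_of_le_one_right (hε_nonneg τ (hsub hτ))
        (Real.exp_le_one_iff.mpr (neg_nonpos.mpr (sub_nonneg.mpr hτ)))
  have htail : Tendsto (fun t => ∫ τ in Set.Ici t, ε τ) atTop (nhds 0) := by
    simp_rw [integral_Ici_eq_integral_Ioi]
    exact tendsto_integral_Ioi_zero tendsto_id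
  refine ⟨hc, hbound, squeeze_zero' ?_ ?_ htail⟩
  · filter_upwards [eventually_ge_atTop 0] with t ht using (hbound t ht).1
  · filter_upwards [eventually_ge_atTop 0] with t ht using (hbound t ht).2
end

section
/- Let (M, μ) be a measure space with 0 < μ(M) = V < ∞, let f : M → [0,∞) be measurable with ∫_M f dμ = V, suppose f·log f is integrable, and let c ≥ 0 be a constant with ∫_M f log f dμ ≤ c·V. Then μ({x ∈ M : f(x) ≥ 1/4}) ≥ (e^{−2(1+c)}/4) · V. -/
open MeasureTheory

/-- Truncating at height `exp L`: above it `t` is controlled by `t log t`, and below it by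
`exp L`, or by `1 / 4` when `t < 1 / 4`. -/
theorem le_quarter_add_indicator_add_mul_log {X : Type*} (f : X → ℝ) (hf : ∀ x, 0 ≤ f x)
    {L : ℝ} (hL : 0 < L) (x : X) :
    f x ≤ 1 / 4 + {y | 1 / 4 ≤ f y}.indicator (fun _ => Real.exp L) x +
      (f x * Real.log (f x) + 1) / L := by
  have hlog : 0 ≤ f x * Real.log (f x) + 1 := by
    rcases (hf x).eq_or_lt with h | h
    · simp [← h]
    · have h₁ := mul_le_mul_of_nonneg_left (Real.one_sub_inv_le_log_of_pos h) h.le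
      rw [mul_sub, mul_inv_cancel₀ h.ne'] at h₁
      linarith
  have hdiv := div_nonneg hlog hL.le
  by_cases hx : 1 / 4 ≤ f x
  · rw [Set.indicator_of_mem (by exact hx)]
    rcases le_total (f x) (Real.exp L) with h | h
    · linarith
    · have h₁ : L ≤ Real.log (f x) := (Real.le_log_iff_exp_le (by linarith)).2 h
      have h₂ : f x ≤ (f x * Real.log (f x) + 1) / L := by
        rw [le_div_iff₀ hL]
        linarith [mul_le_mul_of_nonneg_left h₁ (hf x)]
      linarith [Real.exp_pos L]
  · rw [Set.indicator_of_notMem (by exact hx)]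
    linarith

/-- Measure-theoretic core of the volume-form lower bound: if `f ≥ 0` has mean one
(`∫ f dμ = μ(M)`) and entropy bound `∫ f log f dμ ≤ c μ(M)`, then `f ≥ 1/4` on a set
of measure at least `(e^{-2(1+c)}/4) μ(M)`. -/
theorem entropy_measure_lower_bound {X : Type*} [MeasurableSpace X]
    (μ : Measure X) [IsFiniteMeasure μ] (hpos : 0 < (μ Set.univ).toReal)
    (f : X → ℝ) (hf_meas : Measurable f) (hf_nonneg : ∀ x, 0 ≤ f x)
    (hf_int : Integrable f μ)
    (hmean : ∫ x, f x ∂μ = (μ Set.univ).toReal)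
    (hent_int : Integrable (fun x => f x * Real.log (f x)) μ)
    (c : ℝ) (hc : 0 ≤ c)
    (hent : ∫ x, f x * Real.log (f x) ∂μ ≤ c * (μ Set.univ).toReal) :
    ENNReal.ofReal ((Real.exp (-2 * (1 + c)) / 4) * (μ Set.univ).toReal) ≤
      μ {x | 1 / 4 ≤ f x} := by
  have hL : 0 < 2 * (1 + c) := by linarith
  have hA : MeasurableSet {x | 1 / 4 ≤ f x} := measurableSet_le measurable_const hf_meas
  have hi : Integrable ({x | 1 / 4 ≤ f x}.indicator fun _ => Real.exp (2 * (1 + c))) μ :=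
    (integrable_const _).indicator hA
  have hq : Integrable (fun x => 1 / 4 +
      {x | 1 / 4 ≤ f x}.indicator (fun _ => Real.exp (2 * (1 + c))) x) μ :=
    (integrable_const _).add hi
  have he : Integrable (fun x => f x * Real.log (f x) + 1) μ :=
    hent_int.add (integrable_const _)
  have key := integral_mono hf_int (hq.add (he.div_const (2 * (1 + c))))
    (le_quarter_add_indicator_add_mul_log f hf_nonneg hL)
  simp only [Pi.add_apply] at key
  rw [integral_add hq (he.div_const _), integral_add (integrable_const _) hi, integral_const,
    integral_div, integral_add hent_int (integrable_const _), integral_indicator_const _ hA,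
    hmean, integral_const] at key
  simp only [smul_eq_mul, measureReal_def] at key
  have htail : (∫ x, f x * Real.log (f x) ∂μ + (μ Set.univ).toReal * 1) / (2 * (1 + c)) ≤
      (μ Set.univ).toReal / 2 := by
    rw [div_le_iff₀ hL]
    linarith
  refine ENNReal.ofReal_le_of_le_toReal ?_
  rw [neg_mul, Real.exp_neg, div_mul_eq_mul_div, inv_mul_eq_div, div_div,
    div_le_iff₀ (by positivity)]
  linarith
end

section
/- Let V be a real inner product space, J : V → V a linear map with J∘J = −id and ⟨Jx, Jy⟩ = ⟨x, y⟩ for all x, y ∈ V, and R : V × V × V × V → ℝ a multilinear map satisfying: R(u,v,w,z) = −R(v,u,w,z), R(u,v,w,z) = −R(u,v,z,w), R(u,v,w,z) = R(w,z,u,v), the first Bianchi identity R(u,v,w,z) + R(v,w,u,z) + R(w,u,v,z) = 0, and the Kähler symmetry R(u,v,Jw,Jz) = R(u,v,w,z). Let w₁, w₂ ∈ V be unit vectors with ⟨w₁, w₂⟩ = 0, and assume that either w₂ = J w₁ or w₂ = −J w₁ (the complex lines of w₁ and w₂ are identical), or ⟨w₂, J w₁⟩ = 0 (the complex lines are perpendicular).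 Set a = (w₁ − J w₂)/√2 and b = (w₁ + J w₂)/√2. Then the sectional curvature of the plane spanned by w₁ and w₂ satisfies R(w₁, w₂, w₂, w₁) = (1/4) · ( R(a, Ja, Ja, a) − 2 R(b, Jb, Ja, a) + R(b, Jb, Jb, b) ). -/
open scoped RealInnerProductSpace

/-- Sectional curvature in terms of bisectional curvatures: for orthonormal `w₁, w₂`
whose complex lines are identical or perpendicular, with `a = (w₁ - J w₂)/√2` and
`b = (w₁ + J w₂)/√2`, one has
`R(w₁,w₂,w₂,w₁) = (1/4)(R(a,Ja,Ja,a) - 2 R(b,Jb,Ja,a) + R(b,Jb,Jb,b))`. -/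
theorem sectional_from_bisectional {V : Type*} [NormedAddCommGroup V]
    [InnerProductSpace ℝ V]
    (J : V →ₗ[ℝ] V) (hJ2 : ∀ x, J (J x) = -x)
    (hJinner : ∀ x y : V, ⟪J x, J y⟫ = ⟪x, y⟫)
    (R : V →ₗ[ℝ] V →ₗ[ℝ] V →ₗ[ℝ] V →ₗ[ℝ] ℝ)
    (hanti1 : ∀ u v w z, R u v w z = -R v u w z)
    (hanti2 : ∀ u v w z, R u v w z = -R u v z w)
    (hpair : ∀ u v w z, R u v w z = R w z u v)
    (hbianchi : ∀ u v w z, R u v w z + R v w u z + R w u v z = 0)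
    (hkahler : ∀ u v w z, R u v (J w) (J z) = R u v w z)
    (w₁ w₂ : V) (hw₁ : ‖w₁‖ = 1) (hw₂ : ‖w₂‖ = 1) (horth : ⟪w₁, w₂⟫ = 0)
    (hlines : w₂ = J w₁ ∨ w₂ = -J w₁ ∨ ⟪w₂, J w₁⟫ = 0)
    (a b : V)
    (ha : a = (Real.sqrt 2)⁻¹ • (w₁ - J w₂))
    (hb : b = (Real.sqrt 2)⁻¹ • (w₁ + J w₂)) :
    R w₁ w₂ w₂ w₁ =
      (1 / 4) * (R a (J a) (J a) a - 2 * R b (J b) (J a) a + R b (J b) (J b) b) := by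
  have hleft : ∀ u v w z, R (J u) (J v) w z = R u v w z := fun u v w z => by
    rw [hpair, hkahler, hpair]
  have hhalf : (Real.sqrt 2)⁻¹ * (Real.sqrt 2)⁻¹ = 1 / 2 := by
    rw [← mul_inv, Real.mul_self_sqrt (by norm_num)]
    norm_num
  have hJa : J a = (Real.sqrt 2)⁻¹ • (J w₁ + w₂) := by
    rw [ha, map_smul, map_sub, hJ2, sub_neg_eq_add]
  have hJb : J b = (Real.sqrt 2)⁻¹ • (J w₁ - w₂) := by
    rw [hb, map_smul, map_add, hJ2, ← sub_eq_add_neg]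
  have hsub : ∀ u u' v w z, R (u - u') v w z = R u v w z - R u' v w z := fun u u' v w z => by
    rw [hanti1, map_sub, LinearMap.sub_apply, LinearMap.sub_apply, hanti1 u, hanti1 u']
    ring
  have hdiff : ∀ w z, R a (J a) w z - R b (J b) w z = 2 * R w₁ w₂ w z := fun w z => by
    rw [hJa, hJb, ha, hb]
    simp only [map_smul, map_add, map_sub, hsub, LinearMap.smul_apply, LinearMap.add_apply,
      LinearMap.sub_apply, smul_eq_mul]
    linear_combination
      (2 * R w₁ w₂ w z - 2 * R (J w₂) (J w₁) w z) * hhalf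
        - hleft w₂ w₁ w z - hanti1 w₂ w₁ w z
  linear_combination
    hanti2 w₁ w₂ w₂ w₁ - (1 / 4) * hanti2 a (J a) (J a) a
      + (1 / 2) * hanti2 b (J b) (J a) a - (1 / 4) * hanti2 b (J b) (J b) b
      + (1 / 4) * hdiff a (J a) - (1 / 4) * hdiff b (J b)
      + (1 / 2) * hdiff w₁ w₂ + (1 / 4) * hpair a (J a) b (J b)
      - (1 / 2) * (hpair a (J a) w₁ w₂ - hpair b (J b) w₁ w₂)
end

section
/- Let V be a real inner product space, J : V → V a linear map with J∘J = −id and ⟨Jx, Jy⟩ = ⟨x, y⟩ for all x, y ∈ V, and R : V × V × V × V → ℝ a multilinear map satisfying: R(u,v,w,z) = −R(v,u,w,z), R(u,v,w,z) = −R(u,v,z,w), R(u,v,w,z) = R(w,z,u,v), the first Bianchi identity R(u,v,w,z) + R(v,w,u,z) + R(w,u,v,z) = 0, and the Kähler symmetry R(u,v,Jw,Jz) = R(u,v,w,z). Assume the bisectional curvature is nonnegative and bounded by 1, i.e. 0 ≤ R(x, Jx, Jy, y) ≤ 1 for all unit vectors x, y ∈ V. Then for all unit vectors w₁, w₂ with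 ⟨w₁, w₂⟩ = 0 such that either w₂ = J w₁ or w₂ = −J w₁, or ⟨w₂, J w₁⟩ = 0, the sectional curvature satisfies R(w₁, w₂, w₂, w₁) ≤ 2. -/
open scoped RealInnerProductSpace

/-- On a Kähler curvature tensor, the bisectional curvature is a sum of two sectional
curvatures. -/
lemma bisectional_eq_add {V : Type*} [AddCommGroup V] [Module ℝ V]
    (J : V →ₗ[ℝ] V) (hJ2 : ∀ x, J (J x) = -x)
    (R : V →ₗ[ℝ] V →ₗ[ℝ] V →ₗ[ℝ] V →ₗ[ℝ] ℝ)
    (hanti1 : ∀ u v w z, R u v w z = -R v u w z)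
    (hanti2 : ∀ u v w z, R u v w z = -R u v z w)
    (hpair : ∀ u v w z, R u v w z = R w z u v)
    (hbianchi : ∀ u v w z, R u v w z + R v w u z + R w u v z = 0)
    (hkahler : ∀ u v w z, R u v (J w) (J z) = R u v w z) (x y : V) :
    R x (J x) (J y) y = R x y y x + R x (J y) (J y) x := by
  have h₁ : R (J x) (J y) x y = -R x y y x := by
    rw [hpair, hkahler, hanti2]
  have h₂ : R (J y) x (J x) y = -R x (J y) (J y) x := by
    rw [← hkahler, hJ2, hanti1 x, map_neg, LinearMap.neg_apply, hanti2 (J y) x x, neg_neg]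
  linarith [hbianchi x (J x) (J y) y]

/-- Polarization of the bisectional curvature along `x + y` and `x - y`. -/
lemma bisectional_add_sub {V : Type*} [AddCommGroup V] [Module ℝ V]
    (J : V →ₗ[ℝ] V) (hJ2 : ∀ x, J (J x) = -x)
    (R : V →ₗ[ℝ] V →ₗ[ℝ] V →ₗ[ℝ] V →ₗ[ℝ] ℝ)
    (hanti1 : ∀ u v w z, R u v w z = -R v u w z)
    (hanti2 : ∀ u v w z, R u v w z = -R u v z w)
    (hpair : ∀ u v w z, R u v w z = R w z u v)
    (hbianchi : ∀ u v w z, R u v w z + R v w u z + R w u v z = 0)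
    (hkahler : ∀ u v w z, R u v (J w) (J z) = R u v w z) (x y : V) :
    R (x + y) (J (x + y)) (J (x - y)) (x - y) =
      R x (J x) (J x) x + R y (J y) (J y) y + 2 * (R x y y x - R x (J y) (J y) x) := by
  have swap (u v w z : V) : R u v (J w) z = R u v (J z) w := by
    rw [← hkahler u v (J w) z, hJ2, map_neg, LinearMap.neg_apply, hanti2 u v w, neg_neg]
  have swap' (u v w z : V) : R u (J v) w z = R v (J u) w z := by
    rw [hpair u, hpair v, hanti2 w z u, hanti2 w z v, swap]
  have flip (u v w z : V) : R u (J v) (J w) z = R w (J z) (J u) v := by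
    rw [hpair, hanti1, hanti2, neg_neg, swap', swap]
  have hb := bisectional_eq_add J hJ2 R hanti1 hanti2 hpair hbianchi hkahler x y
  simp only [map_add, map_sub, LinearMap.add_apply, LinearMap.sub_apply]
  linarith [swap x (J x) x y, swap y (J y) x y, swap x (J y) x y, swap y (J x) x y,
    swap' x y (J x) x, swap' x y (J y) y, swap' x y (J x) y, swap' x y (J y) x,
    flip x x y y, flip x x x y, flip x x y x, flip y y x y, flip y y y x]

/-- If the bisectional curvature satisfies `0 ≤ R(x,Jx,Jy,y) ≤ 1` for all unit vectors,
then the sectional curvature of any plane spanned by orthonormal `w₁, w₂` whose complex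
lines are identical or perpendicular is at most `2`. -/
theorem sectional_le_two_of_bisectional_le_one {V : Type*} [NormedAddCommGroup V]
    [InnerProductSpace ℝ V]
    (J : V →ₗ[ℝ] V) (hJ2 : ∀ x, J (J x) = -x)
    (hJinner : ∀ x y : V, ⟪J x, J y⟫ = ⟪x, y⟫)
    (R : V →ₗ[ℝ] V →ₗ[ℝ] V →ₗ[ℝ] V →ₗ[ℝ] ℝ)
    (hanti1 : ∀ u v w z, R u v w z = -R v u w z)
    (hanti2 : ∀ u v w z, R u v w z = -R u v z w)
    (hpair : ∀ u v w z, R u v w z = R w z u v)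
    (hbianchi : ∀ u v w z, R u v w z + R v w u z + R w u v z = 0)
    (hkahler : ∀ u v w z, R u v (J w) (J z) = R u v w z)
    (hbisect : ∀ x y : V, ‖x‖ = 1 → ‖y‖ = 1 →
      0 ≤ R x (J x) (J y) y ∧ R x (J x) (J y) y ≤ 1) :
    ∀ w₁ w₂ : V, ‖w₁‖ = 1 → ‖w₂‖ = 1 → ⟪w₁, w₂⟫ = 0 →
      (w₂ = J w₁ ∨ w₂ = -J w₁ ∨ ⟪w₂, J w₁⟫ = 0) →
      R w₁ w₂ w₂ w₁ ≤ 2 := by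
  intro x y hx hy hxy _
  have hadd := bisectional_eq_add J hJ2 R hanti1 hanti2 hpair hbianchi hkahler x y
  have hpol := bisectional_add_sub J hJ2 R hanti1 hanti2 hpair hbianchi hkahler x y
  have hc : (√2)⁻¹ * (√2)⁻¹ = (1 / 2 : ℝ) := by
    rw [← mul_inv, Real.mul_self_sqrt zero_le_two, one_div]
  have norm_add : ‖x + y‖ = √2 := by
    rw [norm_add_eq_sqrt_iff_real_inner_eq_zero.mpr hxy, hx, hy]
    norm_num
  have norm_sub : ‖x - y‖ = √2 := by
    rw [norm_sub_eq_sqrt_iff_real_inner_eq_zero.mpr hxy, hx, hy]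
    norm_num
  have norm_smul_eq_one {v : V} (hv : ‖v‖ = √2) : ‖(√2)⁻¹ • v‖ = 1 := by
    rw [norm_smul, hv, norm_inv, Real.norm_of_nonneg (Real.sqrt_nonneg 2)]
    exact inv_mul_cancel₀ (by positivity)
  have hle := (hbisect _ _ (norm_smul_eq_one norm_add) (norm_smul_eq_one norm_sub)).2
  simp only [map_smul, LinearMap.smul_apply, smul_eq_mul] at hle
  rw [← mul_assoc, ← mul_assoc, mul_assoc, ← mul_assoc (√2)⁻¹ _ (R _ _ _ _), hc, hpol] at hle
  linarith [(hbisect x y hx hy).2, (hbisect x x hx hx).1, (hbisect y y hy hy).1]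
end
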